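/- arXiv:2002.08446 — 2 statements merged into one kernel-verified Lean document; each statement's English description precedes it below -/
import Mathlib

section
/- Let n ≥ 1 and C, R > 0. The complex-valued function F(t,x,y,z) = (1 + it/(CR))^{-n} (1 − it/(CR))^{-n/2} exp( −(|x|² + |y|²)/(2(CR + it)) ) exp( −|z|²/(2(CR − it)) ) on ℝ × ℝⁿ × ℝⁿ × ℝⁿ is smooth, satisfies the equation i∂_t F + (1/2)(Δ_x + Δ_y − Δ_z)F = 0 for all (t,x,y,z), and has initial value F(0,x,y,z) = exp( −(|x|² + |y|² + |z|²)/(2CR) ). -/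
open scoped BigOperators

noncomputable section

abbrev E (n : ℕ) : Type := EuclideanSpace ℝ (Fin n)

/-- Directional derivative of u : ℝⁿ → ℂ at x in direction v. -/
def dirD (n : ℕ) (v : E n) (u : E n → ℂ) (x : E n) : ℂ :=
  deriv (fun r : ℝ => u (x + r • v)) 0

/-- Laplacian of u : ℝⁿ → ℂ. -/
def lap (n : ℕ) (u : E n → ℂ) (x : E n) : ℂ :=
  ∑ i : Fin n,
    dirD n (EuclideanSpace.single i 1) (dirD n (EuclideanSpace.single i 1) u) x

/-- The vertical tube solution
F(t,x,y,z) = (1+it/(CR))^{-n} (1−it/(CR))^{-n/2}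
  exp(−(|x|²+|y|²)/(2(CR+it))) exp(−|z|²/(2(CR−it))),
where the power (1−it/(CR))^{-n/2} is the principal complex power. -/
def F (n : ℕ) (C R t : ℝ) (x y z : E n) : ℂ :=
  (1 + Complex.I * (t : ℂ) / ((C * R : ℝ) : ℂ)) ^ (-(n : ℤ)) *
    (1 - Complex.I * (t : ℂ) / ((C * R : ℝ) : ℂ)) ^ (((-(n : ℝ) / 2 : ℝ)) : ℂ) *
    Complex.exp (-(((‖x‖ ^ 2 + ‖y‖ ^ 2 : ℝ)) : ℂ) /
      (2 * (((C * R : ℝ) : ℂ) + Complex.I * (t : ℂ)))) *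
    Complex.exp (-((‖z‖ ^ 2 : ℝ) : ℂ) / (2 * (((C * R : ℝ) : ℂ) - Complex.I * (t : ℂ))))

/-- One-dimensional derivative of a Gaussian along a coordinate line. -/
lemma norm_line (n : ℕ) (x : E n) (i : Fin n) (r : ℝ) :
    ‖x + r • (EuclideanSpace.single i (1 : ℝ) : E n)‖ ^ 2 = ‖x‖ ^ 2 + 2 * r * x i + r ^ 2 := by
  rw [norm_add_sq_real, inner_smul_right, EuclideanSpace.inner_single_right, norm_smul]
  simp
  ring

lemma line_deriv (n : ℕ) (c d K : ℂ) (x : E n) (i : Fin n) :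
    HasDerivAt (fun r : ℝ => K * Complex.exp
      (c * ((‖x + r • (EuclideanSpace.single i (1 : ℝ) : E n)‖ ^ 2 : ℝ) : ℂ) + d))
      (2 * c * (x i : ℂ) * (K * Complex.exp (c * ((‖x‖ ^ 2 : ℝ) : ℂ) + d))) 0 := by
  simp_rw [norm_line]
  have h : HasDerivAt (fun r : ℝ => ‖x‖ ^ 2 + 2 * r * x i + r ^ 2) (2 * x i) 0 := by
    have h1 := ((((hasDerivAt_id (0 : ℝ)).const_mul 2).mul_const (x i)).const_add
      (‖x‖ ^ 2)).add ((hasDerivAt_id (0 : ℝ)).pow 2)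
    refine (h1.congr_deriv ?_)
    simp
  have h2 := (((h.ofReal_comp.const_mul c).add_const d).cexp).const_mul K
  refine h2.congr_deriv ?_
  simp
  ring

lemma lap_gauss (n : ℕ) (c d K : ℂ) (x : E n) :
    lap n (fun x => K * Complex.exp (c * ((‖x‖ ^ 2 : ℝ) : ℂ) + d)) x =
      (4 * c ^ 2 * ((‖x‖ ^ 2 : ℝ) : ℂ) + 2 * c * n) *
        (K * Complex.exp (c * ((‖x‖ ^ 2 : ℝ) : ℂ) + d)) := by
  have h1 : ∀ i : Fin n, dirD n (EuclideanSpace.single i 1)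
      (fun x => K * Complex.exp (c * ((‖x‖ ^ 2 : ℝ) : ℂ) + d)) =
      fun x => 2 * c * (x i : ℂ) * (K * Complex.exp (c * ((‖x‖ ^ 2 : ℝ) : ℂ) + d)) := by
    intro i
    funext x
    exact (line_deriv n c d K x i).deriv
  have h2 : ∀ i : Fin n, dirD n (EuclideanSpace.single i 1)
      (dirD n (EuclideanSpace.single i 1)
        (fun x => K * Complex.exp (c * ((‖x‖ ^ 2 : ℝ) : ℂ) + d))) x =
      (4 * c ^ 2 * ((x i ^ 2 : ℝ) : ℂ) + 2 * c) *
        (K * Complex.exp (c * ((‖x‖ ^ 2 : ℝ) : ℂ) + d)) := by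
    intro i
    rw [h1 i]
    have ha : HasDerivAt (fun r : ℝ => 2 * c *
        (((x + r • (EuclideanSpace.single i (1 : ℝ) : E n)) i : ℝ) : ℂ)) (2 * c) 0 := by
      have hb : HasDerivAt (fun r : ℝ =>
          ((x + r • (EuclideanSpace.single i (1 : ℝ) : E n)) i : ℝ)) 1 0 := by
        have := (hasDerivAt_id (0 : ℝ)).const_add (x i)
        simpa using this
      simpa using hb.ofReal_comp.const_mul (2 * c)
    have hc := ha.mul (line_deriv n c d K x i)
    refine hc.deriv.trans ?_
    simp
    ring
  unfold lap
  simp_rw [h2]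
  rw [← Finset.sum_mul, Finset.sum_add_distrib, ← Finset.mul_sum, EuclideanSpace.real_norm_sq_eq]
  congr 1
  simp
  ring

lemma A_ne (a t : ℝ) (ha : 0 < a) : (a : ℂ) + Complex.I * (t : ℂ) ≠ 0 := by
  intro h
  have := congrArg Complex.re h
  simp at this
  exact ha.ne' this

lemma B_ne (a t : ℝ) (ha : 0 < a) : (a : ℂ) - Complex.I * (t : ℂ) ≠ 0 := by
  intro h
  have := congrArg Complex.re h
  simp at this
  exact ha.ne' this

lemma P_ne (a t : ℝ) : 1 + Complex.I * (t : ℂ) / (a : ℂ) ≠ 0 := by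
  intro h
  have := congrArg Complex.re h
  simp [Complex.div_ofReal_re] at this

lemma Q_slit (a t : ℝ) : 1 - Complex.I * (t : ℂ) / (a : ℂ) ∈ Complex.slitPlane := by
  left
  simp [Complex.div_ofReal_re]

lemma time_deriv (n : ℕ) (a t : ℝ) (ha : 0 < a) (X Z : ℂ) :
    HasDerivAt (fun t : ℝ => (1 + Complex.I * (t : ℂ) / (a : ℂ)) ^ (-(n : ℤ)) *
      (1 - Complex.I * (t : ℂ) / (a : ℂ)) ^ (((-(n : ℝ) / 2 : ℝ)) : ℂ) *
      Complex.exp (-X / (2 * ((a : ℂ) + Complex.I * (t : ℂ)))) *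
      Complex.exp (-Z / (2 * ((a : ℂ) - Complex.I * (t : ℂ)))))
      ((-n * Complex.I / (a + Complex.I * t) + n * Complex.I / (2 * (a - Complex.I * t))
        + Complex.I * X / (2 * (a + Complex.I * t) ^ 2)
        - Complex.I * Z / (2 * (a - Complex.I * t) ^ 2)) *
      ((1 + Complex.I * (t : ℂ) / (a : ℂ)) ^ (-(n : ℤ)) *
      (1 - Complex.I * (t : ℂ) / (a : ℂ)) ^ (((-(n : ℝ) / 2 : ℝ)) : ℂ) *
      Complex.exp (-X / (2 * ((a : ℂ) + Complex.I * (t : ℂ)))) *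
      Complex.exp (-Z / (2 * ((a : ℂ) - Complex.I * (t : ℂ)))))) t := by
  have hA := A_ne a t ha
  have hB := B_ne a t ha
  have hP := P_ne a t
  have hQ := Q_slit a t
  have hQ0 := Complex.slitPlane_ne_zero hQ
  have ha0 : (a : ℂ) ≠ 0 := by exact_mod_cast ha.ne'
  have hI : HasDerivAt (fun t : ℂ => Complex.I * t) Complex.I (t : ℂ) := by
    simpa using (hasDerivAt_id (t : ℂ)).const_mul Complex.I
  have d1 : HasDerivAt (fun t : ℂ => (1 + Complex.I * t / (a : ℂ)) ^ (-(n : ℤ)))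
      (-n * Complex.I / (a + Complex.I * t) * (1 + Complex.I * t / (a : ℂ)) ^ (-(n : ℤ))) (t : ℂ) := by
    have := (hasDerivAt_zpow (-(n : ℤ)) _ (Or.inl hP)).comp (t : ℂ)
      ((hI.div_const (a : ℂ)).const_add 1)
    refine this.congr_deriv ?_
    rw [zpow_sub_one₀ hP]
    have e : (a : ℂ) + Complex.I * t = a * (1 + Complex.I * t / a) := by field_simp
    rw [e]
    generalize (1 + Complex.I * (t : ℂ) / a) ^ (-(n : ℤ)) = W at *
    generalize (1 + Complex.I * (t : ℂ) / a) = P at *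
    push_cast
    field_simp
  have d2 : HasDerivAt (fun t : ℂ => (1 - Complex.I * t / (a : ℂ)) ^ (((-(n : ℝ) / 2 : ℝ)) : ℂ))
      (n * Complex.I / (2 * (a - Complex.I * t)) *
        (1 - Complex.I * t / (a : ℂ)) ^ (((-(n : ℝ) / 2 : ℝ)) : ℂ)) (t : ℂ) := by
    have := ((hI.div_const (a : ℂ)).const_sub 1).cpow_const (c := (((-(n : ℝ) / 2 : ℝ)) : ℂ)) hQ
    refine this.congr_deriv ?_
    rw [Complex.cpow_sub _ _ hQ0, Complex.cpow_one]
    have e : (a : ℂ) - Complex.I * t = a * (1 - Complex.I * t / a) := by field_simp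
    rw [e]
    generalize (1 - Complex.I * (t : ℂ) / a) ^ (((-(n : ℝ) / 2 : ℝ)) : ℂ) = W at *
    generalize (1 - Complex.I * (t : ℂ) / a) = P at *
    push_cast
    field_simp
  have d3 : HasDerivAt (fun t : ℂ => Complex.exp (-X / (2 * ((a : ℂ) + Complex.I * t))))
      (Complex.I * X / (2 * (a + Complex.I * t) ^ 2) *
        Complex.exp (-X / (2 * ((a : ℂ) + Complex.I * t)))) (t : ℂ) := by
    have := ((hasDerivAt_const (t : ℂ) (-X)).div ((hI.const_add (a : ℂ)).const_mul 2)
      (mul_ne_zero two_ne_zero hA)).cexp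
    refine this.congr_deriv ?_
    rw [mul_comm]
    congr 1
    field_simp
    ring
  have d4 : HasDerivAt (fun t : ℂ => Complex.exp (-Z / (2 * ((a : ℂ) - Complex.I * t))))
      (-Complex.I * Z / (2 * (a - Complex.I * t) ^ 2) *
        Complex.exp (-Z / (2 * ((a : ℂ) - Complex.I * t)))) (t : ℂ) := by
    have := ((hasDerivAt_const (t : ℂ) (-Z)).div ((hI.const_sub (a : ℂ)).const_mul 2)
      (mul_ne_zero two_ne_zero hB)).cexp
    refine this.congr_deriv ?_
    rw [mul_comm]
    congr 1
    field_simp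
    ring
  have := (((d1.mul d2).mul d3).mul d4).comp_ofReal
  refine this.congr_deriv ?_
  simp only [Pi.mul_apply]
  ring

/-- The vertical tube F is smooth, solves i∂_t F + ½(Δ_x+Δ_y−Δ_z)F = 0, and has
Gaussian initial value exp(−(|x|²+|y|²+|z|²)/(2CR)). -/
theorem tube_solution_G (n : ℕ) (hn : 1 ≤ n) (C R : ℝ) (hC : 0 < C) (hR : 0 < R) :
    ContDiff ℝ (⊤ : ℕ∞) (fun w : ℝ × E n × E n × E n => F n C R w.1 w.2.1 w.2.2.1 w.2.2.2) ∧
    (∀ (t : ℝ) (x y z : E n),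
      Complex.I * deriv (fun τ : ℝ => F n C R τ x y z) t +
        (1/2 : ℂ) * (lap n (fun x' => F n C R t x' y z) x +
                     lap n (fun y' => F n C R t x y' z) y -
                     lap n (fun z' => F n C R t x y z') z) = 0) ∧
    (∀ (x y z : E n),
      F n C R 0 x y z =
        Complex.exp (-(((‖x‖ ^ 2 + ‖y‖ ^ 2 + ‖z‖ ^ 2 : ℝ)) : ℂ) / ((2 * C * R : ℝ) : ℂ))) := by
  have ha : 0 < C * R := mul_pos hC hR
  refine ⟨?_, ?_, ?_⟩
  · unfold F
    generalize C * R = a at ha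
    have hI : ContDiff ℝ (⊤ : ℕ∞) (fun w : ℝ × E n × E n × E n => Complex.I * (w.1 : ℂ)) :=
      contDiff_const.mul (Complex.ofRealCLM.contDiff.comp contDiff_fst)
    have hx : ContDiff ℝ (⊤ : ℕ∞) (fun w : ℝ × E n × E n × E n =>
        ((‖w.2.1‖ ^ 2 + ‖w.2.2.1‖ ^ 2 : ℝ) : ℂ)) :=
      Complex.ofRealCLM.contDiff.comp
        ((contDiff_fst.comp contDiff_snd).norm_sq ℝ |>.add
          ((contDiff_fst.comp (contDiff_snd.comp contDiff_snd)).norm_sq ℝ))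
    have hz : ContDiff ℝ (⊤ : ℕ∞) (fun w : ℝ × E n × E n × E n =>
        ((‖w.2.2.2‖ ^ 2 : ℝ) : ℂ)) :=
      Complex.ofRealCLM.contDiff.comp
        ((contDiff_snd.comp (contDiff_snd.comp contDiff_snd)).norm_sq ℝ)
    refine ContDiff.mul (ContDiff.mul (ContDiff.mul ?_ ?_) ?_) ?_
    · simp_rw [zpow_neg, zpow_natCast]
      exact ((contDiff_const.add (hI.div_const _)).pow n).inv
        (fun w => pow_ne_zero _ (P_ne a w.1))
    · have h : ∀ w : ℝ × E n × E n × E n, (1 - Complex.I * (w.1 : ℂ) / (a : ℂ)) ^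
          (((-(n : ℝ) / 2 : ℝ)) : ℂ) =
          Complex.exp (Complex.log (1 - Complex.I * (w.1 : ℂ) / (a : ℂ)) *
            (((-(n : ℝ) / 2 : ℝ)) : ℂ)) := fun w =>
        Complex.cpow_def_of_ne_zero (Complex.slitPlane_ne_zero (Q_slit a w.1)) _
      simp_rw [h]
      refine ContDiff.cexp (ContDiff.mul ?_ contDiff_const)
      rw [contDiff_iff_contDiffAt]
      intro w
      have h1 : ContDiffAt ℝ (⊤ : ℕ∞) Complex.log (1 - Complex.I * (w.1 : ℂ) / (a : ℂ)) :=
        (Complex.contDiffAt_log (Q_slit a w.1)).restrict_scalars ℝ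
      exact h1.comp w (contDiff_const.sub (hI.div_const (a : ℂ))).contDiffAt
    · simp_rw [div_eq_mul_inv]
      exact (hx.neg.mul ((contDiff_const.mul (contDiff_const.add hI)).inv
        (fun w : ℝ × E n × E n × E n => mul_ne_zero two_ne_zero (A_ne a w.1 ha)))).cexp
    · simp_rw [div_eq_mul_inv]
      exact (hz.neg.mul ((contDiff_const.mul (contDiff_const.sub hI)).inv
        (fun w : ℝ × E n × E n × E n => mul_ne_zero two_ne_zero (B_ne a w.1 ha)))).cexp
  · intro t x y z
    have hA := A_ne (C * R) t ha
    have hB := B_ne (C * R) t ha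
    have hd : deriv (fun τ : ℝ => F n C R τ x y z) t = _ :=
      (time_deriv n (C * R) t ha ((‖x‖ ^ 2 + ‖y‖ ^ 2 : ℝ) : ℂ) ((‖z‖ ^ 2 : ℝ) : ℂ)).deriv
    rw [hd]
    change _ * (_ * F n C R t x y z) + _ = _
    have e1 : ∀ x y z : E n, F n C R t x y z =
        ((1 + Complex.I * (t : ℂ) / ((C * R : ℝ) : ℂ)) ^ (-(n : ℤ)) *
        (1 - Complex.I * (t : ℂ) / ((C * R : ℝ) : ℂ)) ^ (((-(n : ℝ) / 2 : ℝ)) : ℂ)) *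
        Complex.exp (-1 / (2 * (((C * R : ℝ) : ℂ) + Complex.I * t)) * ((‖x‖ ^ 2 : ℝ) : ℂ) +
          (-1 / (2 * (((C * R : ℝ) : ℂ) + Complex.I * t)) * ((‖y‖ ^ 2 : ℝ) : ℂ) +
          -1 / (2 * (((C * R : ℝ) : ℂ) - Complex.I * t)) * ((‖z‖ ^ 2 : ℝ) : ℂ))) := by
      intro x y z
      unfold F
      rw [mul_assoc, ← Complex.exp_add]
      congr 2
      push_cast
      ring
    have e2 := fun x y z => (e1 x y z).trans (congrArg (fun u => _ * Complex.exp u)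
      (add_left_comm _ _ _))
    have e3 := fun x y z => (e1 x y z).trans (congrArg (fun u => _ * Complex.exp u)
      ((add_assoc _ _ _).symm.trans (add_comm _ _)))
    have l1 : lap n (fun x' => F n C R t x' y z) x =
        (4 * (-1 / (2 * (((C * R : ℝ) : ℂ) + Complex.I * t))) ^ 2 * ((‖x‖ ^ 2 : ℝ) : ℂ) +
          2 * (-1 / (2 * (((C * R : ℝ) : ℂ) + Complex.I * t))) * n) *
        F n C R t x y z := by
      rw [funext fun x' => e1 x' y z, lap_gauss, ← e1]
    have l2 : lap n (fun y' => F n C R t x y' z) y =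
        (4 * (-1 / (2 * (((C * R : ℝ) : ℂ) + Complex.I * t))) ^ 2 * ((‖y‖ ^ 2 : ℝ) : ℂ) +
          2 * (-1 / (2 * (((C * R : ℝ) : ℂ) + Complex.I * t))) * n) *
        F n C R t x y z := by
      rw [funext fun y' => e2 x y' z, lap_gauss, ← e2]
    have l3 : lap n (fun z' => F n C R t x y z') z =
        (4 * (-1 / (2 * (((C * R : ℝ) : ℂ) - Complex.I * t))) ^ 2 * ((‖z‖ ^ 2 : ℝ) : ℂ) +
          2 * (-1 / (2 * (((C * R : ℝ) : ℂ) - Complex.I * t))) * n) *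
        F n C R t x y z := by
      rw [funext fun z' => e3 x y z', lap_gauss]
    rw [l1, l2, l3]
    generalize F n C R t x y z = W
    generalize (((C * R : ℝ) : ℂ) + Complex.I * t) = A at *
    generalize (((C * R : ℝ) : ℂ) - Complex.I * t) = B at *
    push_cast
    field_simp
    ring_nf
    simp only [Complex.I_sq]
    ring
  · intro x y z
    unfold F
    simp only [Complex.ofReal_zero, mul_zero, zero_div, add_zero, sub_zero, one_zpow,
      Complex.one_cpow, one_mul]
    rw [← Complex.exp_add]
    congr 1
    push_cast
    ring

end
end

section
/- Let n ≥ 1. There exist constants c = c(n) > 0 and R₀ = R₀(n) ≥ 1 such that for every R ≥ R₀ there are an integer N ≥ c·R^{(3n−1)/2} and points (x₁,y₁,z₁), …, (x_N,y_N,z_N) ∈ ℝⁿ × ℝⁿ × ℝⁿ satisfying: (i) |x_k|² + |y_k|² = |z_k|² and R/2 ≤ |x_k|, |y_k| ≤ R for every k; (ii) the points are pairwise √R-separated in ℝ^{3n}: |(x_k,y_k,z_k) − (x_l,y_l,z_l)| ≥ √R whenever k ≠ l; and (iii) every coordinate of x_k, y_k and z_k is ≥ R/(10n). -/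
open scoped BigOperators

noncomputable section

/-- Euclidean norm of a triple (x,y,z) ∈ ℝⁿ × ℝⁿ × ℝⁿ, viewed as a point of ℝ^{3n}. -/
def tripleNorm (n : ℕ) (w : E n × E n × E n) : ℝ :=
  Real.sqrt (‖w.1‖ ^ 2 + ‖w.2.1‖ ^ 2 + ‖w.2.2‖ ^ 2)

/-- Existence of ≳ R^{(3n−1)/2} many √R-separated points on the cone
{|x|²+|y|² = |z|²} in ℝ^{3n}, with R/2 ≤ |x|, |y| ≤ R and all coordinates ≥ R/(10n). -/
theorem separated_points_on_cone (n : ℕ) (hn : 1 ≤ n) :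
    ∃ c > (0:ℝ), ∃ R₀ ≥ (1:ℝ), ∀ R ≥ R₀, ∃ N : ℕ, ∃ P : Fin N → E n × E n × E n,
      c * R ^ ((3 * (n : ℝ) - 1) / 2) ≤ (N : ℝ) ∧
      (∀ k, ‖(P k).1‖ ^ 2 + ‖(P k).2.1‖ ^ 2 = ‖(P k).2.2‖ ^ 2) ∧
      (∀ k, R / 2 ≤ ‖(P k).1‖ ∧ ‖(P k).1‖ ≤ R ∧ R / 2 ≤ ‖(P k).2.1‖ ∧ ‖(P k).2.1‖ ≤ R) ∧
      (∀ k l, k ≠ l → Real.sqrt R ≤ tripleNorm n (P k - P l)) ∧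
      (∀ k (i : Fin n), R / (10 * n) ≤ (P k).1 i ∧ R / (10 * n) ≤ (P k).2.1 i ∧
        R / (10 * n) ≤ (P k).2.2 i) := by
  obtain ⟨m, rfl⟩ : ∃ m, n = m + 1 := ⟨n - 1, by omega⟩
  set s : ℝ := Real.sqrt ((m + 1 : ℕ) : ℝ) with hs
  have hs2 : s ^ 2 = ((m + 1 : ℕ) : ℝ) := Real.sq_sqrt (by positivity)
  have hs1 : 1 ≤ s := by
    rw [hs]; apply Real.one_le_sqrt.2; exact_mod_cast hn
  have hs0 : 0 < s := by linarith
  refine ⟨(1 / 5 / s) ^ (3 * m + 2), by positivity, 1, le_refl _, ?_⟩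
  intro R hR
  set t : ℝ := Real.sqrt R with ht
  have ht2 : t ^ 2 = R := Real.sq_sqrt (by linarith)
  have ht1 : 1 ≤ t := by rw [ht]; exact Real.one_le_sqrt.2 hR
  have hR0 : 0 < R := by linarith
  set M : ℕ := ⌊1 / 5 / s * t⌋₊ + 1 with hM
  set g : Fin M → ℝ := fun a => 3 / 5 * (R / s) + t * (a : ℕ) with hg
  have gl : ∀ a, 3 / 5 * (R / s) ≤ g a := by
    intro a
    have : 0 ≤ t * ((a : ℕ) : ℝ) := by positivity
    simp only [hg]; linarith
  have gu : ∀ a, g a ≤ 4 / 5 * (R / s) := by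
    intro a
    have h1 : (a : ℕ) ≤ ⌊1 / 5 / s * t⌋₊ := by have := a.2; omega
    have h2 : ((a : ℕ) : ℝ) ≤ 1 / 5 / s * t :=
      le_trans (by exact_mod_cast h1) (Nat.floor_le (by positivity))
    have h3 : t * ((a : ℕ) : ℝ) ≤ t * (1 / 5 / s * t) := by gcongr
    have h4 : t * (1 / 5 / s * t) = 1 / 5 * (R / s) := by rw [← ht2]; ring
    simp only [hg]; linarith
  have gsep : ∀ a b, a ≠ b → R ≤ (g a - g b) ^ 2 := by
    intro a b hab
    have h1 : ((a : ℕ) : ℤ) - (b : ℕ) ≠ 0 := by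
      intro h; apply hab; ext; omega
    have h2 : 1 ≤ (((a : ℕ) : ℤ) - (b : ℕ)) ^ 2 := by
      have := sq_pos_of_ne_zero h1; omega
    have h3 : (1 : ℝ) ≤ (((a : ℕ) : ℝ) - (b : ℕ)) ^ 2 := by exact_mod_cast h2
    have h4 : (g a - g b) ^ 2 = R * (((a : ℕ) : ℝ) - (b : ℕ)) ^ 2 := by
      rw [← ht2]; simp only [hg]; ring
    rw [h4]; nlinarith
  have hw0 : 0 < R / s := by positivity
  have hw2 : (R / s) ^ 2 * ((m : ℝ) + 1) = R ^ 2 := by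
    have : (m : ℝ) + 1 = s ^ 2 := by rw [hs2]; push_cast; ring
    rw [this]; field_simp
  have gsql : ∀ a, 9 / 25 * (R / s) ^ 2 ≤ g a ^ 2 := by
    intro a; have := gl a; nlinarith
  have gsqu : ∀ a, g a ^ 2 ≤ 16 / 25 * (R / s) ^ 2 := by
    intro a; have := gl a; have := gu a; nlinarith
  have suml : ∀ f : Fin (m + 1) → Fin M, 9 / 25 * R ^ 2 ≤ ∑ i, g (f i) ^ 2 := by
    intro f
    have := Finset.card_nsmul_le_sum Finset.univ (fun i => g (f i) ^ 2) _ (fun i _ => gsql (f i))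
    simp only [Finset.card_univ, Fintype.card_fin, nsmul_eq_mul] at this
    push_cast at this
    linarith
  have sumu : ∀ k : ℕ, ∀ f : Fin k → Fin M, k ≤ m + 1 → ∑ i, g (f i) ^ 2 ≤ 16 / 25 * R ^ 2 := by
    intro k f hk
    have := Finset.sum_le_card_nsmul Finset.univ (fun i => g (f i) ^ 2) _ (fun i _ => gsqu (f i))
    simp only [Finset.card_univ, Fintype.card_fin, nsmul_eq_mul] at this
    have hk' : (k : ℝ) ≤ (m : ℝ) + 1 := by exact_mod_cast hk
    have : (k : ℝ) * (16 / 25 * (R / s) ^ 2) ≤ ((m : ℝ) + 1) * (16 / 25 * (R / s) ^ 2) := by gcongr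
    linarith
  have hlow : R / (10 * ((m + 1 : ℕ) : ℝ)) ≤ 3 / 5 * (R / s) := by
    rw [← hs2, div_le_iff₀ (by positivity)]
    have : 3 / 5 * (R / s) * (10 * s ^ 2) = 6 * R * s := by field_simp; ring
    rw [this]; nlinarith
  have hlow2 : R / (10 * ((m + 1 : ℕ) : ℝ)) ≤ R / 10 := by
    have : (1 : ℝ) ≤ ((m + 1 : ℕ) : ℝ) := by exact_mod_cast hn
    gcongr; linarith
  let X := (Fin (m + 1) → Fin M) × (Fin (m + 1) → Fin M) × (Fin m → Fin M)
  let z0 : X → ℝ := fun f => Real.sqrt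
    (∑ i, g (f.1 i) ^ 2 + ∑ i, g (f.2.1 i) ^ 2 - ∑ i, g (f.2.2 i) ^ 2)
  have hz0 : ∀ f : X, 2 / 25 * R ^ 2 ≤
      ∑ i, g (f.1 i) ^ 2 + ∑ i, g (f.2.1 i) ^ 2 - ∑ i, g (f.2.2 i) ^ 2 := by
    intro f
    have h1 := suml f.1
    have h2 := suml f.2.1
    have h3 := sumu m f.2.2 (by omega)
    linarith
  have hz0s : ∀ f : X, z0 f ^ 2 =
      ∑ i, g (f.1 i) ^ 2 + ∑ i, g (f.2.1 i) ^ 2 - ∑ i, g (f.2.2 i) ^ 2 := by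
    intro f
    exact Real.sq_sqrt (le_trans (by positivity) (hz0 f))
  have hz0l : ∀ f : X, R / 10 ≤ z0 f := by
    intro f
    apply Real.le_sqrt_of_sq_le
    have := hz0 f
    nlinarith
  let Q : X → E (m + 1) × E (m + 1) × E (m + 1) := fun f =>
    (WithLp.toLp 2 (fun i => g (f.1 i)), WithLp.toLp 2 (fun i => g (f.2.1 i)),
      WithLp.toLp 2 (Fin.cons (z0 f) (fun i => g (f.2.2 i))))
  have nx : ∀ f : X, ‖(Q f).1‖ ^ 2 = ∑ i, g (f.1 i) ^ 2 := by
    intro f; simp [Q, EuclideanSpace.real_norm_sq_eq]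
  have ny : ∀ f : X, ‖(Q f).2.1‖ ^ 2 = ∑ i, g (f.2.1 i) ^ 2 := by
    intro f; simp [Q, EuclideanSpace.real_norm_sq_eq]
  have nz : ∀ f : X, ‖(Q f).2.2‖ ^ 2 = z0 f ^ 2 + ∑ i, g (f.2.2 i) ^ 2 := by
    intro f; simp [Q, EuclideanSpace.real_norm_sq_eq, Fin.sum_univ_succ]
  have rng : ∀ f : Fin (m + 1) → Fin M, ∀ a : ℝ, 0 ≤ a → a ^ 2 = ∑ i, g (f i) ^ 2 →
      R / 2 ≤ a ∧ a ≤ R := by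
    intro f a ha h
    have h1 := suml f
    have h2 := sumu _ f le_rfl
    constructor
    · apply le_of_sq_le_sq _ ha; nlinarith
    · apply le_of_sq_le_sq _ hR0.le; nlinarith
  have coordle : ∀ (v : E (m + 1)) (i : Fin (m + 1)), v i ^ 2 ≤ ‖v‖ ^ 2 := by
    intro v i
    rw [EuclideanSpace.real_norm_sq_eq]
    exact Finset.single_le_sum (f := fun i => v i ^ 2) (fun i _ => sq_nonneg _) (Finset.mem_univ i)
  have sep : ∀ f h : X, f ≠ h → t ≤ tripleNorm (m + 1) (Q f - Q h) := by
    intro f h hfh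
    apply Real.sqrt_le_sqrt
    have p1 := sq_nonneg ‖(Q f - Q h).1‖
    have p2 := sq_nonneg ‖(Q f - Q h).2.1‖
    have p3 := sq_nonneg ‖(Q f - Q h).2.2‖
    by_cases e1 : f.1 = h.1
    · by_cases e2 : f.2.1 = h.2.1
      · have e3 : f.2.2 ≠ h.2.2 := fun e3 => hfh (Prod.ext e1 (Prod.ext e2 e3))
        obtain ⟨i, hi⟩ := Function.ne_iff.1 e3
        have a1 := coordle (Q f - Q h).2.2 i.succ
        have a2 : (Q f - Q h).2.2 i.succ = g (f.2.2 i) - g (h.2.2 i) := by simp [Q]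
        rw [a2] at a1
        linarith [gsep _ _ hi]
      · obtain ⟨i, hi⟩ := Function.ne_iff.1 e2
        have a1 := coordle (Q f - Q h).2.1 i
        have a2 : (Q f - Q h).2.1 i = g (f.2.1 i) - g (h.2.1 i) := by simp [Q]
        rw [a2] at a1
        linarith [gsep _ _ hi]
    · obtain ⟨i, hi⟩ := Function.ne_iff.1 e1
      have a1 := coordle (Q f - Q h).1 i
      have a2 : (Q f - Q h).1 i = g (f.1 i) - g (h.1 i) := by simp [Q]
      rw [a2] at a1
      linarith [gsep _ _ hi]
  have hcard : Fintype.card X = M ^ (3 * m + 2) := by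
    simp only [X, Fintype.card_prod, Fintype.card_fun, Fintype.card_fin]
    ring
  let e := (Fintype.equivFin X).symm
  refine ⟨Fintype.card X, fun k => Q (e k), ?_, ?_, ?_, ?_, ?_⟩
  · rw [hcard]
    have h1 : R ^ ((3 * ((m + 1 : ℕ) : ℝ) - 1) / 2) = t ^ (3 * m + 2) := by
      rw [ht, Real.sqrt_eq_rpow, ← Real.rpow_natCast, ← Real.rpow_mul hR0.le]
      congr 1; push_cast; ring
    rw [h1, ← mul_pow]
    push_cast
    gcongr
    rw [hM]; push_cast
    exact (Nat.lt_floor_add_one _).le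
  · intro k
    rw [nx, ny, nz, hz0s]; ring
  · intro k
    have h1 := rng _ _ (norm_nonneg _) (nx (e k))
    have h2 := rng _ _ (norm_nonneg _) (ny (e k))
    exact ⟨h1.1, h1.2, h2.1, h2.2⟩
  · intro k l hkl
    exact sep _ _ (fun h => hkl (e.injective h))
  · intro k i
    refine ⟨hlow.trans (gl _), hlow.trans (gl _), ?_⟩
    refine Fin.cases ?_ (fun j => ?_) i
    · exact hlow2.trans (hz0l _)
    · exact hlow.trans (gl _)

end
end
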